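/- Let N_R ≥ 2 and N ≥ 1 be natural numbers with N ≤ N_R − 1, let x ≥ 0 and σ be real numbers, and let f(v) = Σ_{n₂=0}^{∞} (e^{−x} x^{n₂}/n₂!) · v^{N_R−2}(1−v)^{n₂}/B(N_R−1, n₂+1) for v ∈ (0,1) be the noncentral beta density of B(N_R−1, 1, x). Then ∫₀¹ ₁F₁(N; N_R−1; σv) · f(v) dv = Σ_{n₂=0}^{∞} (e^{−x} x^{n₂}/n₂!) · ₁F₁(N; N_R + n₂; σ), where the series on the right converges absolutely. -/

import Mathlib

/-- The Beta function `B(a,b) = ∫₀¹ v^{a−1}(1−v)^{b−1} dv`. -/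
noncomputable def betaInt (a b : ℝ) : ℝ :=
  ∫ v in (0:ℝ)..1, v ^ (a - 1) * (1 - v) ^ (b - 1)

/-- The confluent hypergeometric function `₁F₁(a; c; σ) = Σₙ ((a)ₙ/(c)ₙ) σⁿ/n!`. -/
noncomputable def oneF1 (a c σ : ℝ) : ℝ :=
  ∑' n : ℕ, ((ascPochhammer ℝ n).eval a / (ascPochhammer ℝ n).eval c) * σ ^ n / n.factorial

open MeasureTheory in
lemma aux_beta (b : ℕ) : ∀ a : ℕ, (∫ v in (0:ℝ)..1, v ^ a * (1 - v) ^ b) =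
    (a.factorial : ℝ) * b.factorial / (a + b + 1).factorial := by
  induction b with
  | zero =>
    intro a
    have : ((a.factorial : ℕ) : ℝ) ≠ 0 := by positivity
    simp [Nat.factorial_succ]
    field_simp
  | succ b ih =>
    intro a
    have h : (∫ v in (0:ℝ)..1, v ^ a * (1 - v) ^ (b + 1)) =
        (∫ v in (0:ℝ)..1, v ^ a * (1 - v) ^ b) - ∫ v in (0:ℝ)..1, v ^ (a + 1) * (1 - v) ^ b := by
      rw [← intervalIntegral.integral_sub]
      · congr 1; ext v; ring
      · exact Continuous.intervalIntegrable (by fun_prop) _ _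
      · exact Continuous.intervalIntegrable (by fun_prop) _ _
    rw [h, ih, ih, show a + 1 + b + 1 = (a + b + 1) + 1 by ring,
      show a + (b + 1) + 1 = (a + b + 1) + 1 by ring]
    rw [Nat.factorial_succ (a + b + 1), Nat.factorial_succ a, Nat.factorial_succ b]
    have : (((a + b + 1).factorial : ℕ) : ℝ) ≠ 0 := by positivity
    push_cast
    field_simp
    ring

lemma aux_betaInt (a b : ℕ) : betaInt ((a : ℝ) + 1) ((b : ℝ) + 1) =
    (a.factorial : ℝ) * b.factorial / (a + b + 1).factorial := by
  rw [← aux_beta, betaInt]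
  simp [Real.rpow_natCast]

lemma aux_poch (k n : ℕ) : (ascPochhammer ℝ n).eval ((k : ℝ) + 1) =
    ((k + n).factorial : ℝ) / k.factorial := by
  have h := Nat.factorial_mul_ascFactorial k n
  have h2 : (ascPochhammer ℝ n).eval ((k : ℝ) + 1) = ((k + 1).ascFactorial n : ℝ) := by
    rw [← ascPochhammer_nat_eq_ascFactorial, ascPochhammer_eval_cast]; simp
  have : ((k.factorial : ℕ) : ℝ) ≠ 0 := by positivity
  rw [h2, ← h]
  push_cast
  field_simp

lemma aux_mono (N k n : ℕ) (h : N ≤ k) :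
    (ascPochhammer ℝ n).eval (N : ℝ) ≤ (ascPochhammer ℝ n).eval (k : ℝ) ∧
    0 ≤ (ascPochhammer ℝ n).eval (N : ℝ) := by
  induction n with
  | zero => simp
  | succ n ih =>
    rw [ascPochhammer_succ_eval, ascPochhammer_succ_eval]
    have h' : (N : ℝ) ≤ k := by exact_mod_cast h
    refine ⟨mul_le_mul ih.1 (by linarith) (by positivity) (ih.2.trans ih.1),
      mul_nonneg ih.2 (by positivity)⟩

lemma aux_ratio (N m n : ℕ) (h : N ≤ m + 1) :
    0 ≤ (ascPochhammer ℝ n).eval (N : ℝ) / (ascPochhammer ℝ n).eval ((m : ℝ) + 1) ∧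
    (ascPochhammer ℝ n).eval (N : ℝ) / (ascPochhammer ℝ n).eval ((m : ℝ) + 1) ≤ 1 := by
  obtain ⟨h1, h2⟩ := aux_mono N (m + 1) n h
  push_cast at h1
  exact ⟨div_nonneg h2 (h2.trans h1), div_le_one_of_le₀ h1 (h2.trans h1)⟩

lemma aux_bound (m k : ℕ) : 0 ≤ (betaInt ((m : ℝ) + 1) ((k : ℝ) + 1))⁻¹ ∧
    (betaInt ((m : ℝ) + 1) ((k : ℝ) + 1))⁻¹ ≤ ((m : ℝ) + 1) * 2 ^ (m + 1) * 2 ^ k := by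
  rw [aux_betaInt]
  refine ⟨by positivity, ?_⟩
  have h1 := Nat.choose_le_two_pow (m + 1 + k) k
  have h2 := Nat.add_choose_mul_factorial_mul_factorial (m + 1) k
  have h1' : (((m + 1 + k).choose k : ℕ) : ℝ) ≤ 2 ^ (m + 1 + k) := by exact_mod_cast h1
  have h2' : (((m + k + 1).factorial : ℕ) : ℝ) =
      ((m + 1 + k).choose k : ℕ) * (((m : ℝ) + 1) * m.factorial) * k.factorial := by
    rw [show m + k + 1 = m + 1 + k by ring, ← h2, Nat.factorial_succ]; push_cast; ring
  have e : ((m.factorial : ℝ) * k.factorial / (m + k + 1).factorial)⁻¹ =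
      ((m + 1 + k).choose k : ℕ) * ((m : ℝ) + 1) := by
    rw [inv_div, h2']
    field_simp
  rw [e]
  calc _ ≤ (2 : ℝ) ^ (m + 1 + k) * ((m : ℝ) + 1) := by gcongr
    _ = _ := by ring

/-- The Poisson weights. -/
noncomputable def auxW (x : ℝ) (k : ℕ) : ℝ := Real.exp (-x) * x ^ k / k.factorial

/-- The coefficients of the hypergeometric series. -/
noncomputable def auxA (N m n : ℕ) : ℝ :=
  (ascPochhammer ℝ n).eval (N : ℝ) / (ascPochhammer ℝ n).eval ((m : ℝ) + 1)

/-- The double-indexed summand. -/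
noncomputable def auxF (N m : ℕ) (x σ : ℝ) (p : ℕ × ℕ) (v : ℝ) : ℝ :=
  (auxW x p.1 * (v ^ m * (1 - v) ^ p.1 / betaInt ((m : ℝ) + 1) ((p.1 : ℝ) + 1))) *
    (auxA N m p.2 * (σ * v) ^ p.2 / p.2.factorial)

/-- The dominating terms. -/
noncomputable def auxB (m : ℕ) (x σ : ℝ) (p : ℕ × ℕ) : ℝ :=
  (Real.exp (-x) * (((m : ℝ) + 1) * 2 ^ (m + 1)) * ((2 * x) ^ p.1 / p.1.factorial)) *
    (|σ| ^ p.2 / p.2.factorial)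

lemma aux_B_summable (m : ℕ) (x σ : ℝ) (hx : 0 ≤ x) : Summable (auxB m x σ) := by
  exact Summable.mul_of_nonneg
    (f := fun k : ℕ => Real.exp (-x) * (((m : ℝ) + 1) * 2 ^ (m + 1)) * ((2 * x) ^ k / k.factorial))
    (g := fun n : ℕ => |σ| ^ n / n.factorial)
    ((Real.summable_pow_div_factorial (2 * x)).mul_left _)
    (Real.summable_pow_div_factorial |σ|)
    (fun k => by simp only [Pi.zero_apply]; positivity)
    (fun k => by simp only [Pi.zero_apply]; positivity)

lemma aux_f_bound (m : ℕ) (x : ℝ) (hx : 0 ≤ x) (k : ℕ) (v : ℝ) (h0 : 0 ≤ v) (h1 : v ≤ 1) :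
    |auxW x k * (v ^ m * (1 - v) ^ k / betaInt ((m : ℝ) + 1) ((k : ℝ) + 1))| ≤
    Real.exp (-x) * (((m : ℝ) + 1) * 2 ^ (m + 1)) * ((2 * x) ^ k / k.factorial) := by
  obtain ⟨b0, b1⟩ := aux_bound m k
  have hv : 0 ≤ 1 - v := by linarith
  have hw : 0 ≤ auxW x k := by unfold auxW; positivity
  rw [div_eq_mul_inv, abs_of_nonneg (by positivity)]
  calc _ ≤ auxW x k * (1 * 1 * (((m : ℝ) + 1) * 2 ^ (m + 1) * 2 ^ k)) := by
        gcongr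
        · exact pow_le_one₀ h0 h1
        · exact pow_le_one₀ hv (by linarith)
    _ = _ := by unfold auxW; rw [mul_pow]; ring

lemma aux_g_bound (N m : ℕ) (h : N ≤ m + 1) (σ : ℝ) (n : ℕ) (v : ℝ) (h0 : 0 ≤ v) (h1 : v ≤ 1) :
    |auxA N m n * (σ * v) ^ n / n.factorial| ≤ |σ| ^ n / n.factorial := by
  obtain ⟨a0, a1⟩ := aux_ratio N m n h
  rw [abs_div, abs_mul, abs_pow, abs_mul, abs_of_nonneg h0, auxA, abs_of_nonneg a0,
    Nat.abs_cast, mul_pow]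
  have : v ^ n ≤ 1 := pow_le_one₀ h0 h1
  gcongr
  calc _ ≤ 1 * (|σ| ^ n * 1) := by gcongr
    _ = _ := by ring

lemma aux_F_bound (N m : ℕ) (h : N ≤ m + 1) (x σ : ℝ) (hx : 0 ≤ x) (p : ℕ × ℕ) (v : ℝ)
    (h0 : 0 ≤ v) (h1 : v ≤ 1) : |auxF N m x σ p v| ≤ auxB m x σ p := by
  rw [auxF, abs_mul, auxB]
  exact mul_le_mul (aux_f_bound m x hx p.1 v h0 h1) (aux_g_bound N m h σ p.2 v h0 h1)
    (abs_nonneg _) (by positivity)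

lemma aux_F_int (N m : ℕ) (x σ : ℝ) (p : ℕ × ℕ) :
    (∫ v in (0:ℝ)..1, auxF N m x σ p v) = auxW x p.1 *
      (((ascPochhammer ℝ p.2).eval (N : ℝ) /
        (ascPochhammer ℝ p.2).eval ((m : ℝ) + 2 + (p.1 : ℝ))) * σ ^ p.2 / p.2.factorial) := by
  obtain ⟨k, n⟩ := p
  have e : ∀ v, auxF N m x σ (k, n) v = (auxW x k / betaInt ((m : ℝ) + 1) ((k : ℝ) + 1) *
      (auxA N m n * σ ^ n / n.factorial)) * (v ^ (m + n) * (1 - v) ^ k) := by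
    intro v; simp only [auxF]; rw [mul_pow, pow_add]; ring
  simp only [e, intervalIntegral.integral_const_mul]
  rw [aux_beta, aux_betaInt, auxA, aux_poch]
  have e2 : (m : ℝ) + 2 + k = ((m + k + 1 : ℕ) : ℝ) + 1 := by push_cast; ring
  rw [e2, aux_poch, show m + n + k + 1 = m + k + 1 + n by ring]
  field_simp

/-- Averaging `₁F₁(N; N_R−1; σv)` over the noncentral beta density of
`B(N_R−1, 1, x)` (with `N_R = m+2`) yields the Poisson-weighted mixture
`Σ_{n₂} (e^{−x}x^{n₂}/n₂!) ₁F₁(N; N_R+n₂; σ)`, with absolute convergence. -/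
theorem stmt18 (m N : ℕ) (hN : 1 ≤ N) (hNle : N ≤ m + 1)
    (x σ : ℝ) (hx : 0 ≤ x)
    (f : ℝ → ℝ)
    (hf : ∀ v : ℝ, f v = ∑' n₂ : ℕ, (Real.exp (-x) * x ^ n₂ / n₂.factorial) *
        (v ^ m * (1 - v) ^ n₂ / betaInt ((m : ℝ) + 1) ((n₂ : ℝ) + 1))) :
    Summable (fun n₂ : ℕ => |(Real.exp (-x) * x ^ n₂ / n₂.factorial) *
        oneF1 (N : ℝ) ((m : ℝ) + 2 + (n₂ : ℝ)) σ|) ∧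
    (∫ v in (0:ℝ)..1, oneF1 (N : ℝ) ((m : ℝ) + 1) (σ * v) * f v) =
      ∑' n₂ : ℕ, (Real.exp (-x) * x ^ n₂ / n₂.factorial) *
        oneF1 (N : ℝ) ((m : ℝ) + 2 + (n₂ : ℝ)) σ := by
  have hB := aux_B_summable m x σ hx
  have key : HasSum (fun p => ∫ v in (0:ℝ)..1, auxF N m x σ p v)
      (∫ v in (0:ℝ)..1, oneF1 (N : ℝ) ((m : ℝ) + 1) (σ * v) * f v) := by
    apply intervalIntegral.hasSum_integral_of_dominated_convergence (fun p _ => auxB m x σ p)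
    · intro p
      apply Continuous.aestronglyMeasurable
      unfold auxF
      fun_prop
    · intro p
      refine Filter.Eventually.of_forall fun v hv => ?_
      rw [Set.uIoc_of_le zero_le_one] at hv
      exact aux_F_bound N m hNle x σ hx p v hv.1.le hv.2
    · exact Filter.Eventually.of_forall fun v _ => hB
    · simp
    · refine Filter.Eventually.of_forall fun v hv => ?_
      rw [Set.uIoc_of_le zero_le_one] at hv
      rw [mul_comm, hf]
      have s1 := Summable.of_norm_bounded
        (f := fun k : ℕ => auxW x k * (v ^ m * (1 - v) ^ k /
          betaInt ((m : ℝ) + 1) ((k : ℝ) + 1)))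
        ((Real.summable_pow_div_factorial (2 * x)).mul_left
          (Real.exp (-x) * (((m : ℝ) + 1) * 2 ^ (m + 1))))
        (fun k => aux_f_bound m x hx k v hv.1.le hv.2)
      have s2 := Summable.of_norm_bounded
        (f := fun n : ℕ => auxA N m n * (σ * v) ^ n / n.factorial) (Real.summable_pow_div_factorial |σ|)
        (fun n => aux_g_bound N m hNle σ n v hv.1.le hv.2)
      exact s1.hasSum.mul s2.hasSum (Summable.of_norm_bounded hB
        (fun p => aux_F_bound N m hNle x σ hx p v hv.1.le hv.2))
  simp only [aux_F_int] at key
  have e : ∀ k : ℕ, (Real.exp (-x) * x ^ k / k.factorial) *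
        oneF1 (N : ℝ) ((m : ℝ) + 2 + (k : ℝ)) σ = ∑' n : ℕ, auxW x k *
      (((ascPochhammer ℝ n).eval (N : ℝ) /
        (ascPochhammer ℝ n).eval ((m : ℝ) + 2 + (k : ℝ))) * σ ^ n / n.factorial) := by
    intro k
    rw [tsum_mul_left]; rfl
  simp only [e]
  exact ⟨key.summable.prod.abs, by rw [← key.tsum_eq, key.summable.tsum_prod]⟩
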